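/- Let 𝔬 be the ring of integers of a number field of degree d over ℚ. There exists a constant M > 0 such that for all nonzero y ∈ 𝔬 with |N(y)| ≥ 3, one has |N(y)| ≤ M · φ(y) · (log log |N(y)|)^d, where N(y) is the field norm of y and φ(y) = |(𝔬/y𝔬)^×|. -/

import Mathlib

open NumberField

lemma aux_mertens (N : ℕ) (hN : 1 ≤ N) :
    ∑ p ∈ Nat.primesLE N, Real.log p / p ≤ Real.log N + Real.log 4 := by
  have hN0 : (0:ℝ) < N := by exact_mod_cast hN
  have hprime : ∀ p ∈ Nat.primesLE N, p.Prime := fun p hp => (Nat.mem_primesLE.1 hp).2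
  have hdvd : (∏ p ∈ Nat.primesLE N, p ^ (N / p)) ∣ N.factorial := by
    apply Finset.prod_dvd_of_isRelPrime
    · intro p hp q hq hpq
      simp only [Function.onFun]
      exact Nat.coprime_iff_isRelPrime.1 (Nat.Coprime.pow _ _ ((Nat.coprime_primes (hprime p hp) (hprime q hq)).2 hpq))
    · intro p hp
      have h1 : (p * (N / p)).factorial ∣ N.factorial :=
        Nat.factorial_dvd_factorial (Nat.mul_div_le N p)
      refine dvd_trans ?_ h1
      refine ((hprime p hp).pow_dvd_iff_le_factorization (Nat.factorial_ne_zero _)).2 ?_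
      rw [Nat.factorization_factorial_mul (hprime p hp)]
      omega
  have hlog : ∑ p ∈ Nat.primesLE N, ((N / p : ℕ) : ℝ) * Real.log p ≤ N * Real.log N := by
    have h1 : ((∏ p ∈ Nat.primesLE N, p ^ (N / p) : ℕ) : ℝ) ≤ (N:ℝ) ^ N := by
      exact_mod_cast (Nat.le_of_dvd (Nat.factorial_pos _) hdvd).trans (Nat.factorial_le_pow N)
    have hpos : (0:ℝ) < ((∏ p ∈ Nat.primesLE N, p ^ (N / p) : ℕ) : ℝ) := by
      exact_mod_cast Finset.prod_pos fun p hp => pow_pos (hprime p hp).pos _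
    have h2 := Real.log_le_log hpos h1
    rw [Real.log_pow] at h2
    push_cast at h2
    rw [Real.log_prod] at h2
    · simpa [Real.log_pow] using h2
    · intro p hp
      have := (hprime p hp).ne_zero
      positivity
  have hth : ∑ p ∈ Nat.primesLE N, Real.log p ≤ Real.log 4 * N := by
    rw [← Chebyshev.theta_eq_sum_primesLE_log]
    exact Chebyshev.theta_le_log4_mul_x hN0.le
  have : N * ∑ p ∈ Nat.primesLE N, Real.log p / p ≤ N * (Real.log N + Real.log 4) := by
    calc N * ∑ p ∈ Nat.primesLE N, Real.log p / p
        ≤ ∑ p ∈ Nat.primesLE N, (((N / p : ℕ) : ℝ) * Real.log p + Real.log p) := by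
          rw [Finset.mul_sum]
          apply Finset.sum_le_sum
          intro p hp
          have hp0 : (0:ℝ) < p := by exact_mod_cast (hprime p hp).pos
          have hl : 0 ≤ Real.log p := Real.log_natCast_nonneg p
          have h3 : (N:ℝ) / p ≤ ((N / p : ℕ) : ℝ) + 1 := by
            rw [← Nat.floor_div_eq_div (K := ℝ)]
            exact (Nat.lt_floor_add_one _).le
          calc (N:ℝ) * (Real.log p / p) = (N / p) * Real.log p := by ring
            _ ≤ (((N / p : ℕ) : ℝ) + 1) * Real.log p := by gcongr
            _ = _ := by ring
      _ ≤ N * Real.log N + Real.log 4 * N := by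
          rw [Finset.sum_add_distrib]; linarith
      _ = _ := by ring
  exact le_of_mul_le_mul_left this hN0

lemma aux_step (σ : ℝ) (hσ : 0 < σ) (k : ℕ) :
    ((k + 2 : ℕ) : ℝ) ^ (-(1 + σ)) ≤
      1 / σ * (((k + 1 : ℕ) : ℝ) ^ (-σ) - ((k + 2 : ℕ) : ℝ) ^ (-σ)) := by
  set m : ℝ := ((k + 2 : ℕ) : ℝ) with hm
  have hm2 : 2 ≤ m := by rw [hm]; push_cast; linarith [(Nat.cast_nonneg k : (0:ℝ) ≤ k)]
  have hm0 : 0 < m := by linarith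
  have hinv : 1 / m ≤ 1 / 2 := one_div_le_one_div_of_le (by norm_num) hm2
  have h1 : ((k + 1 : ℕ) : ℝ) = m * (1 - 1 / m) := by
    rw [mul_sub, mul_one_div_cancel hm0.ne', hm]; push_cast; ring
  have hq : 0 < 1 - 1 / m := by linarith
  have h2 : 1 + σ / m ≤ (1 - 1 / m) ^ (-σ) := by
    rw [Real.rpow_def_of_pos hq]
    have h3 := Real.add_one_le_exp (Real.log (1 - 1 / m) * -σ)
    have h4 := Real.log_le_sub_one_of_pos hq
    have h5 : σ / m = σ * (1 / m) := by ring
    nlinarith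
  rw [h1, Real.mul_rpow hm0.le hq.le, neg_add, Real.rpow_add hm0, Real.rpow_neg_one]
  have h6 : 0 < m ^ (-σ) := Real.rpow_pos_of_pos hm0 _
  calc m⁻¹ * m ^ (-σ) = 1 / σ * (m ^ (-σ) * (1 + σ / m) - m ^ (-σ)) := by field_simp; ring
    _ ≤ _ := by gcongr

lemma aux_zeta (σ : ℝ) (hσ : 0 < σ) : ∑' n : ℕ, (n : ℝ) ^ (-(1 + σ)) ≤ 1 + 1 / σ := by
  have key : ∀ k : ℕ, ∑ i ∈ Finset.range (k + 2), (i : ℝ) ^ (-(1 + σ)) ≤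
      1 + 1 / σ * (1 - ((k + 1 : ℕ) : ℝ) ^ (-σ)) := by
    intro k
    induction k with
    | zero =>
      have : (0:ℝ) ^ (-(1 + σ)) = 0 := Real.zero_rpow (by linarith)
      simp [Finset.sum_range_succ, -neg_add_rev, this]
    | succ k ih =>
      rw [Finset.sum_range_succ]
      have := aux_step σ hσ k
      have e : k + 1 + 1 = k + 2 := rfl
      rw [e]
      linarith
  apply Real.tsum_le_of_sum_range_le (fun n => by positivity)
  intro n
  refine (Finset.sum_le_sum_of_subset_of_nonneg (Finset.range_mono (by omega : n ≤ n + 2))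
    (fun i _ _ => by positivity)).trans ((key n).trans ?_)
  have : 0 ≤ 1 / σ * ((n + 1 : ℕ) : ℝ) ^ (-σ) := by positivity
  linarith

lemma aux_euler (σ : ℝ) (hσ : 0 < σ) (S : Finset ℕ) (hS : ∀ p ∈ S, p.Prime) :
    ∏ p ∈ S, (1 - (p : ℝ) ^ (-(1 + σ)))⁻¹ ≤ 1 + 1 / σ := by
  let f : ℕ →* ℝ :=
    { toFun := fun n => (n : ℝ) ^ (-(1 + σ))
      map_one' := by simp
      map_mul' := fun a b => by
        push_cast
        exact Real.mul_rpow (Nat.cast_nonneg _) (Nat.cast_nonneg _) }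
  have hlt : ∀ {p : ℕ}, p.Prime → ‖f p‖ < 1 := by
    intro p hp
    have h1 : (1:ℝ) < p := by exact_mod_cast hp.one_lt
    have : f p = (p : ℝ) ^ (-(1 + σ)) := rfl
    rw [this, Real.norm_of_nonneg (by positivity)]
    exact Real.rpow_lt_one_of_one_lt_of_neg h1 (by linarith)
  have h := (EulerProduct.summable_and_hasSum_factoredNumbers_prod_filter_prime_geometric hlt S).2
  rw [Finset.filter_true_of_mem hS] at h
  have hs : Summable (fun n : ℕ => (n : ℝ) ^ (-(1 + σ))) :=
    Real.summable_nat_rpow.2 (by linarith)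
  calc ∏ p ∈ S, (1 - (p : ℝ) ^ (-(1 + σ)))⁻¹ = ∑' m : Nat.factoredNumbers S, f m := h.tsum_eq.symm
    _ ≤ ∑' n : ℕ, (n : ℝ) ^ (-(1 + σ)) :=
      hs.tsum_subtype_le (fun n : ℕ => (n : ℝ) ^ (-(1 + σ))) _ (fun n => by positivity)
    _ ≤ _ := aux_zeta σ hσ

lemma aux_sum (n : ℕ) (hn : 3 ≤ n) :
    ∑ p ∈ n.primeFactors, Real.log p / p ≤ Real.log (Real.log n) + (Real.log 4 + 1) := by
  have hL : 1 < Real.log n := by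
    rw [Real.lt_log_iff_exp_lt (by positivity)]
    have : (3:ℝ) ≤ n := by exact_mod_cast hn
    linarith [Real.exp_one_lt_d9]
  set N := ⌊Real.log n⌋₊ with hN
  have hN1 : 1 ≤ N := Nat.le_floor (by simpa using hL.le)
  have hprime : ∀ p ∈ n.primeFactors, p.Prime := fun p hp => Nat.prime_of_mem_primeFactors hp
  rw [← Finset.sum_filter_add_sum_filter_not n.primeFactors (fun p => p ≤ N)]
  have h1 : ∑ p ∈ n.primeFactors with p ≤ N, Real.log p / p ≤
      Real.log (Real.log n) + Real.log 4 := by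
    calc _ ≤ ∑ p ∈ Nat.primesLE N, Real.log p / p := by
          apply Finset.sum_le_sum_of_subset_of_nonneg
          · intro p hp
            rw [Finset.mem_filter] at hp
            exact Nat.mem_primesLE.2 ⟨hp.2, hprime p hp.1⟩
          · intro p _ _
            have := Real.log_natCast_nonneg p
            positivity
      _ ≤ Real.log N + Real.log 4 := aux_mertens N hN1
      _ ≤ _ := by
        gcongr
        exact Nat.floor_le (by linarith)
  have h2 : ∑ p ∈ n.primeFactors with ¬ p ≤ N, Real.log p / p ≤ 1 := by
    calc _ ≤ ∑ p ∈ n.primeFactors with ¬ p ≤ N, Real.log p / Real.log n := by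
          apply Finset.sum_le_sum
          intro p hp
          rw [Finset.mem_filter, not_le] at hp
          have : Real.log n < p := (Nat.floor_lt (by linarith)).1 hp.2
          have := Real.log_natCast_nonneg p
          gcongr
      _ ≤ ∑ p ∈ n.primeFactors, Real.log p / Real.log n := by
          apply Finset.sum_le_sum_of_subset_of_nonneg (Finset.filter_subset _ _)
          intro p _ _
          have := Real.log_natCast_nonneg p
          positivity
      _ = (∑ p ∈ n.primeFactors, Real.log p) / Real.log n := by rw [Finset.sum_div]
      _ ≤ 1 := by
          rw [div_le_one (by linarith), ← Real.log_prod]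
          · apply Real.log_le_log
            · exact Finset.prod_pos fun p hp => by exact_mod_cast (hprime p hp).pos
            · have := Nat.le_of_dvd (by omega) (Nat.prod_primeFactors_dvd n)
              rw [← Nat.cast_prod]
              exact Nat.cast_le.2 this
          · intro p hp
            have := (hprime p hp).ne_zero
            positivity
  linarith

lemma aux_ratio (σ : ℝ) (hσ : 0 < σ) (p : ℕ) (hp : p.Prime) :
    (1 - 1 / (p : ℝ))⁻¹ ≤
      (1 - (p : ℝ) ^ (-(1 + σ)))⁻¹ * Real.exp (2 * σ * (Real.log p / p)) := by
  have hp2 : (2:ℝ) ≤ p := by exact_mod_cast hp.two_le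
  have hp0 : (0:ℝ) < p := by linarith
  have hinv : 1 / (p:ℝ) ≤ 1 / 2 := one_div_le_one_div_of_le (by norm_num) hp2
  have hinv0 : 0 < 1 / (p:ℝ) := by positivity
  have hb : (p : ℝ) ^ (-(1 + σ)) = 1 / p * (p:ℝ) ^ (-σ) := by
    rw [neg_add, Real.rpow_add hp0, Real.rpow_neg_one, one_div]
  have hl : 0 ≤ Real.log p := Real.log_natCast_nonneg p
  have h1 : 1 - σ * Real.log p ≤ (p:ℝ) ^ (-σ) := by
    rw [Real.rpow_def_of_pos hp0]
    have := Real.add_one_le_exp (Real.log p * -σ)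
    linarith
  have h1' : (p:ℝ) ^ (-σ) ≤ 1 := Real.rpow_le_one_of_one_le_of_nonpos (by linarith) (by linarith)
  set a := 1 / (p:ℝ) with ha
  set t := (p:ℝ) ^ (-σ)
  have hdiv : Real.log p / p = Real.log p * a := by rw [ha]; ring
  have hlt : 0 < 1 - a * t := by nlinarith
  rw [hb, hdiv]
  have hexp := Real.add_one_le_exp (2 * σ * (Real.log p * a))
  rw [inv_mul_eq_div, le_div_iff₀ hlt, inv_mul_le_iff₀ (by linarith)]
  have h5 : 0 ≤ σ * Real.log p * a := by positivity
  have h6 : 1 - a * t ≤ 1 - a + σ * Real.log p * a := by nlinarith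
  have h7 : (1 - a) * (2 * σ * (Real.log p * a) + 1) ≤ (1 - a) * Real.exp (2 * σ * (Real.log p * a)) :=
    mul_le_mul_of_nonneg_left hexp (by linarith)
  nlinarith

lemma aux_main : ∃ C : ℝ, 0 < C ∧ ∀ n : ℕ, 3 ≤ n →
    ∏ p ∈ n.primeFactors, (1 - 1 / (p : ℝ))⁻¹ ≤ C * Real.log (Real.log n) := by
  have h3 : 1 < Real.log 3 := by
    rw [Real.lt_log_iff_exp_lt (by positivity)]
    linarith [Real.exp_one_lt_d9]
  set L₀ := Real.log (Real.log 3) with hL₀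
  have hL₀p : 0 < L₀ := Real.log_pos h3
  have h4 : 0 ≤ Real.log 4 := Real.log_nonneg (by norm_num)
  refine ⟨(1 / L₀ + 1) * Real.exp (2 + 2 * (Real.log 4 + 1) / L₀), by positivity, fun n hn => ?_⟩
  have hn' : (3:ℝ) ≤ n := by exact_mod_cast hn
  set L := Real.log (Real.log n) with hL
  have hLL : L₀ ≤ L := Real.log_le_log (by linarith) (Real.log_le_log (by norm_num) hn')
  have hLp : 0 < L := by linarith
  have hprime : ∀ p ∈ n.primeFactors, p.Prime := fun p hp => Nat.prime_of_mem_primeFactors hp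
  calc ∏ p ∈ n.primeFactors, (1 - 1 / (p : ℝ))⁻¹
      ≤ ∏ p ∈ n.primeFactors, ((1 - (p : ℝ) ^ (-(1 + 1 / L)))⁻¹ *
          Real.exp (2 * (1 / L) * (Real.log p / p))) := by
        apply Finset.prod_le_prod
        · intro p hp
          have hp2 : (2:ℝ) ≤ p := by exact_mod_cast (hprime p hp).two_le
          have hinv : 1 / (p:ℝ) ≤ 1 / 2 := one_div_le_one_div_of_le (by norm_num) hp2
          exact inv_nonneg.2 (by linarith)
        · intro p hp
          exact aux_ratio _ (by positivity) p (hprime p hp)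
    _ = (∏ p ∈ n.primeFactors, (1 - (p : ℝ) ^ (-(1 + 1 / L)))⁻¹) *
          Real.exp (2 * (1 / L) * ∑ p ∈ n.primeFactors, (Real.log p / p)) := by
        rw [Finset.prod_mul_distrib, ← Real.exp_sum, Finset.mul_sum]
    _ ≤ (1 + 1 / (1 / L)) * Real.exp (2 * (1 / L) * (L + (Real.log 4 + 1))) := by
        gcongr
        · exact aux_euler _ (by positivity) _ hprime
        · exact aux_sum n hn
    _ ≤ ((1 / L₀ + 1) * L) * Real.exp (2 + 2 * (Real.log 4 + 1) / L₀) := by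
        have e1 : 2 * (1 / L) * (L + (Real.log 4 + 1)) = 2 + 2 * (Real.log 4 + 1) / L := by
          field_simp
        rw [e1, one_div_one_div]
        have : 1 ≤ 1 / L₀ * L := by rw [one_div_mul_eq_div, one_le_div hL₀p]; exact hLL
        gcongr
        linarith
    _ = _ := by ring

lemma aux_card_units (R : Type*) [CommRing R] [Finite R] :
    (Nat.card R : ℝ) = Nat.card Rˣ *
      ∏ᶠ m : MaximalSpectrum R, (1 - 1 / (Nat.card (R ⧸ m.asIdeal) : ℝ))⁻¹ := by
  classical
  have : Fintype (MaximalSpectrum R) := Fintype.ofFinite _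
  rw [finprod_eq_prod_of_fintype]
  let I := nilradical R
  have hI : IsNilpotent I := IsArtinianRing.isNilpotent_nilradical
  let e : R ≃ (R ⧸ I) × I := AddSubgroup.addGroupEquivQuotientProdAddSubgroup (s := I.toAddSubgroup)
  have he : ∀ x, (e x).1 = Ideal.Quotient.mk I x := fun x => rfl
  have h1 : Nat.card R = Nat.card (R ⧸ I) * Nat.card I := by
    rw [Nat.card_congr e, Nat.card_prod]
  have h2 : Nat.card Rˣ = Nat.card (R ⧸ I)ˣ * Nat.card I := by
    let e1 : Rˣ ≃ {x : R // IsUnit x} := (Equiv.ofBijective (fun u : Rˣ => (⟨u, u.isUnit⟩ : {x : R // IsUnit x}))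
      ⟨fun u v h => Units.ext (congrArg Subtype.val h), fun x => ⟨x.2.unit, rfl⟩⟩)
    let e2 : (R ⧸ I)ˣ ≃ {x : R ⧸ I // IsUnit x} := (Equiv.ofBijective (fun u : (R ⧸ I)ˣ => (⟨u, u.isUnit⟩ : {x : R ⧸ I // IsUnit x}))
      ⟨fun u v h => Units.ext (congrArg Subtype.val h), fun x => ⟨x.2.unit, rfl⟩⟩)
    let e3 : {x : R // IsUnit x} ≃ {z : (R ⧸ I) × I // IsUnit z.1} :=
      e.subtypeEquiv fun x => by
        rw [he]; exact (IsNilpotent.isUnit_quotient_mk_iff hI).symm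
    let e4 : {z : (R ⧸ I) × I // IsUnit z.1} ≃ {x : R ⧸ I // IsUnit x} × I :=
      { toFun := fun z => (⟨z.1.1, z.2⟩, z.1.2)
        invFun := fun w => ⟨(w.1.1, w.2), w.1.2⟩
        left_inv := fun _ => rfl
        right_inv := fun _ => rfl }
    rw [Nat.card_congr (e1.trans (e3.trans e4)), Nat.card_prod, Nat.card_congr e2]
  let E : (R ⧸ I) ≃ₐ[R] ∀ m : MaximalSpectrum R, R ⧸ m.asIdeal :=
    IsArtinianRing.quotNilradicalEquivPi R
  have h3 : Nat.card (R ⧸ I) = ∏ m : MaximalSpectrum R, Nat.card (R ⧸ m.asIdeal) := by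
    rw [Nat.card_congr E.toEquiv, Nat.card_pi]
  have h4 : Nat.card (R ⧸ I)ˣ = ∏ m : MaximalSpectrum R, (Nat.card (R ⧸ m.asIdeal) - 1) := by
    rw [Nat.card_congr (Units.mapEquiv E.toMulEquiv).toEquiv, Nat.card_congr MulEquiv.piUnits.toEquiv,
      Nat.card_pi]
    refine Finset.prod_congr rfl fun m _ => ?_
    letI : Field (R ⧸ m.asIdeal) := Ideal.Quotient.field m.asIdeal
    exact Nat.card_units (R ⧸ m.asIdeal)
  rw [h1, h2, h3, h4]
  push_cast
  rw [mul_right_comm, ← Finset.prod_mul_distrib]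
  congr 1
  refine Finset.prod_congr rfl fun m _ => ?_
  have : Nontrivial (R ⧸ m.asIdeal) := Ideal.Quotient.nontrivial_iff.2 m.isMaximal.ne_top
  have hfin : Finite (R ⧸ m.asIdeal) := Finite.of_surjective _ (Ideal.Quotient.mk_surjective (I := m.asIdeal))
  have h5 : 1 < Nat.card (R ⧸ m.asIdeal) := Finite.one_lt_card
  rw [Nat.cast_sub h5.le]
  have h6 : (1:ℝ) < Nat.card (R ⧸ m.asIdeal) := by exact_mod_cast h5
  have h7 : (Nat.card (R ⧸ m.asIdeal) : ℝ) - 1 ≠ 0 := by linarith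
  have h8 : (Nat.card (R ⧸ m.asIdeal) : ℝ) ≠ 0 := by linarith
  field_simp
  push_cast
  field_simp

lemma aux_fiber (K : Type) [Field K] [NumberField K] (p : ℕ) (hp : p.Prime) (T : Finset (Ideal (𝓞 K)))
    (hT : ∀ P ∈ T, P.IsPrime ∧ (p : 𝓞 K) ∈ P) : T.card ≤ Module.finrank ℚ K := by
  have hpZ : Prime (p : ℤ) := Nat.prime_iff_prime_int.1 hp
  have hp0 : Ideal.span {(p : ℤ)} ≠ ⊥ := by simpa using hp.ne_zero
  have : (Ideal.span {(p : ℤ)}).IsPrime := (Ideal.span_singleton_prime hpZ.ne_zero).2 hpZ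
  have hmax : (Ideal.span {(p : ℤ)}).IsMaximal := this.isMaximal hp0
  refine le_trans (Finset.card_le_card ?_)
    (Ideal.card_primesOverFinset_le_finrank (S := 𝓞 K) ℚ K hp0)
  intro P hP
  obtain ⟨h1, h2⟩ := hT P hP
  rw [IsDedekindDomain.mem_primesOverFinset_iff hp0]
  refine ⟨h1, ⟨?_⟩⟩
  refine hmax.eq_of_le ?_ ?_
  · exact Ideal.IsPrime.ne_top (Ideal.IsPrime.under ℤ P)
  · rw [Ideal.span_singleton_le_iff_mem, Ideal.mem_comap]
    simpa using h2

lemma aux_prod (K : Type) [Field K] [NumberField K] (y : 𝓞 K) (hy : y ≠ 0) :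
    ((Algebra.norm ℤ y).natAbs : ℝ) ≤ Nat.card ((𝓞 K ⧸ Ideal.span {y})ˣ) *
      (∏ p ∈ (Algebra.norm ℤ y).natAbs.primeFactors, (1 - 1 / (p : ℝ))⁻¹) ^ Module.finrank ℚ K := by
  classical
  set n := (Algebra.norm ℤ y).natAbs with hn
  have hn0 : n ≠ 0 := by
    rw [hn, Int.natAbs_ne_zero]; exact Algebra.norm_ne_zero_iff.2 hy
  set R := 𝓞 K ⧸ Ideal.span {y} with hR
  have hcard : Nat.card R = n := by
    rw [hn, ← Ideal.absNorm_span_singleton, Ideal.absNorm_apply, Submodule.cardQuot_apply]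
  have : Finite R := Nat.finite_of_card_ne_zero (by rw [hcard]; exact hn0)
  have : Fintype (MaximalSpectrum R) := Fintype.ofFinite _
  rw [← hcard, aux_card_units R, finprod_eq_prod_of_fintype, hcard]
  let c : MaximalSpectrum R → ℕ := fun m => ringChar (R ⧸ m.asIdeal)
  have hc : ∀ m, (c m).Prime ∧ c m ≤ Nat.card (R ⧸ m.asIdeal) ∧ c m ∈ n.primeFactors ∧
      (c m : R) ∈ m.asIdeal := by
    intro m
    letI : Field (R ⧸ m.asIdeal) := Ideal.Quotient.field m.asIdeal
    have hfin : Finite (R ⧸ m.asIdeal) := Finite.of_surjective _ (Ideal.Quotient.mk_surjective (I := m.asIdeal))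
    have : Fintype (R ⧸ m.asIdeal) := Fintype.ofFinite _
    have hpr : (c m).Prime := CharP.char_is_prime (R ⧸ m.asIdeal) _
    have hd : c m ∣ Nat.card (R ⧸ m.asIdeal) := by
      rw [← CharP.cast_eq_zero_iff (R ⧸ m.asIdeal) (c m), Nat.card_eq_fintype_card]
      exact Nat.cast_card_eq_zero _
    refine ⟨hpr, Nat.le_of_dvd Nat.card_pos hd, Nat.mem_primeFactors.2 ⟨hpr, hd.trans ?_, hn0⟩, ?_⟩
    · rw [← hcard]
      exact AddSubgroup.card_quotient_dvd_card (m.asIdeal.toAddSubgroup)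
    · rw [← Ideal.Quotient.eq_zero_iff_mem, map_natCast]
      exact CharP.cast_eq_zero _ _
  gcongr
  have hpos : ∀ k : ℕ, 2 ≤ k → 0 < 1 - 1 / (k:ℝ) ∧ 1 - 1 / (k:ℝ) ≤ 1 := by
    intro k hk
    have hp2 : (2:ℝ) ≤ k := by exact_mod_cast hk
    have hinv : 1 / (k:ℝ) ≤ 1 / 2 := one_div_le_one_div_of_le (by norm_num) hp2
    have : 0 ≤ 1 / (k:ℝ) := by positivity
    constructor <;> linarith
  calc ∏ m : MaximalSpectrum R, (1 - 1 / (Nat.card (R ⧸ m.asIdeal) : ℝ))⁻¹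
      ≤ ∏ m : MaximalSpectrum R, (1 - 1 / (c m : ℝ))⁻¹ := by
        apply Finset.prod_le_prod
        · intro m _
          exact inv_nonneg.2 (hpos _ ((hc m).1.two_le.trans (hc m).2.1)).1.le
        · intro m _
          have h1 := (hpos _ (hc m).1.two_le).1
          have h2 : (0:ℝ) < c m := by exact_mod_cast (hc m).1.pos
          have h3 : (c m : ℝ) ≤ Nat.card (R ⧸ m.asIdeal) := by exact_mod_cast (hc m).2.1
          gcongr
    _ = ∏ p ∈ n.primeFactors, ∏ m : MaximalSpectrum R with c m = p, (1 - 1 / (c m : ℝ))⁻¹ :=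
        (Finset.prod_fiberwise_of_maps_to (fun m _ => (hc m).2.2.1) _).symm
    _ ≤ ∏ p ∈ n.primeFactors, ((1 - 1 / (p : ℝ))⁻¹) ^ Module.finrank ℚ K := by
        apply Finset.prod_le_prod
        · intro p hp
          exact Finset.prod_nonneg fun m _ => inv_nonneg.2 (hpos _ (hc m).1.two_le).1.le
        · intro p hp
          have hpp := Nat.prime_of_mem_primeFactors hp
          have h1 : ∏ m : MaximalSpectrum R with c m = p, (1 - 1 / (c m : ℝ))⁻¹ =
              ∏ m : MaximalSpectrum R with c m = p, (1 - 1 / (p : ℝ))⁻¹ :=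
            Finset.prod_congr rfl fun m hm => by rw [(Finset.mem_filter.1 hm).2]
          rw [h1, Finset.prod_const]
          obtain ⟨ha, hb⟩ := hpos p hpp.two_le
          apply pow_le_pow_right₀ ((one_le_inv₀ ha).2 hb)
          let g : MaximalSpectrum R → Ideal (𝓞 K) := fun m =>
            m.asIdeal.comap (Ideal.Quotient.mk (Ideal.span {y}))
          have hg : Function.Injective g := fun a b h =>
            MaximalSpectrum.ext (Ideal.comap_injective_of_surjective _ Ideal.Quotient.mk_surjective h)
          rw [← Finset.card_image_of_injective _ hg]
          apply aux_fiber K p hpp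
          intro P hP
          obtain ⟨m, hm, rfl⟩ := Finset.mem_image.1 hP
          have := m.isMaximal.isPrime
          refine ⟨Ideal.IsPrime.comap _, ?_⟩
          rw [Ideal.mem_comap, map_natCast, ← (Finset.mem_filter.1 hm).2]
          exact (hc m).2.2.2
    _ = _ := by rw [Finset.prod_pow]


/-- Let `𝔬` be the ring of integers of a number field of
degree `d` over `ℚ`. There is a constant `M > 0` such that for all nonzero
`y ∈ 𝔬` with `|N(y)| ≥ 3`, one has
`|N(y)| ≤ M · φ(y) · (log log |N(y)|)^d`, where `φ(y) = |(𝔬/y𝔬)ˣ|`. -/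
theorem stmt_9 (K : Type) [Field K] [NumberField K] :
    ∃ M : ℝ, 0 < M ∧ ∀ y : 𝓞 K, y ≠ 0 → 3 ≤ (Algebra.norm ℤ y).natAbs →
      ((Algebra.norm ℤ y).natAbs : ℝ) ≤
        M * (Nat.card ((𝓞 K ⧸ Ideal.span {y})ˣ) : ℝ) *
          (Real.log (Real.log ((Algebra.norm ℤ y).natAbs : ℝ))) ^
            (Module.finrank ℚ K) := by
  obtain ⟨C, hC, h⟩ := aux_main
  refine ⟨C ^ Module.finrank ℚ K, by positivity, fun y hy hn => ?_⟩
  have h0 : 0 ≤ ∏ p ∈ (Algebra.norm ℤ y).natAbs.primeFactors, (1 - 1 / (p : ℝ))⁻¹ := by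
    refine Finset.prod_nonneg fun p hp => inv_nonneg.2 ?_
    have hp1 : (1:ℝ) ≤ p := by exact_mod_cast (Nat.prime_of_mem_primeFactors hp).one_le
    rw [sub_nonneg]
    exact (div_le_one (by linarith)).2 hp1
  have h1 := pow_le_pow_left₀ h0 (h _ hn) (Module.finrank ℚ K)
  rw [mul_pow] at h1
  refine (aux_prod K y hy).trans ?_
  refine (mul_le_mul_of_nonneg_left h1 (Nat.cast_nonneg _)).trans (le_of_eq ?_)
  ring
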